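/- Let 0 ≤ λ < γ ≤ α, φ ∈ 𝔐_{2λ}, and u₁(x,t) = ∫_{ℚ_p⁴} Z(x − y, t) φ(y) d⁴y for t > 0. Then for every t > 0, u₁(·,t) lies in the domain of f(∂,γ) and (f(∂,γ)u₁)(x,t) = ∫_{ℚ_p⁴} (f(∂,γ)Z_t)(x − y) φ(y) d⁴y. -/

import Mathlib

open MeasureTheory Real Filter Set

noncomputable section

namespace PadicParabolic

variable (p : ℕ) [Fact p.Prime]

instance : MeasurableSpace ℚ_[p] := borel _
instance : BorelSpace ℚ_[p] := ⟨rfl⟩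

/-- The four dimensional vector space over `ℚ_[p]`, with the max-norm
`‖x‖ = max_{1 ≤ i ≤ 4} |x_i|_p`. -/
abbrev V (p : ℕ) [Fact p.Prime] := Fin 4 → ℚ_[p]

/-- `a` is a quadratic non-residue modulo `p`. -/
def IsQNR (a : ℤ) : Prop := ∀ b : ZMod p, b ^ 2 ≠ (a : ZMod p)

/-- The elliptic quadratic form `f(x) = x₁² − a x₂² − p x₃² + a p x₄²`. -/
def qf (a : ℤ) (x : V p) : ℚ_[p] :=
  x 0 ^ 2 - (a : ℚ_[p]) * x 1 ^ 2 - (p : ℚ_[p]) * x 2 ^ 2 + (a : ℚ_[p]) * (p : ℚ_[p]) * x 3 ^ 2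

/-- The dual elliptic quadratic form `f°(ξ) = a p ξ₁² − p ξ₂² − a ξ₃² + ξ₄²`. -/
def qfc (a : ℤ) (x : V p) : ℚ_[p] :=
  (a : ℚ_[p]) * (p : ℚ_[p]) * x 0 ^ 2 - (p : ℚ_[p]) * x 1 ^ 2 - (a : ℚ_[p]) * x 2 ^ 2 + x 3 ^ 2

/-- `χ` is the standard additive character `χ(y) = exp(2πi {y}_p)` of `ℚ_p`, characterized as
the unique continuous function with `χ(m/pⁿ) = exp(2πi m/pⁿ)`. -/
def IsStdChar (χ : ℚ_[p] → ℂ) : Prop :=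
  Continuous χ ∧ ∀ (m : ℤ) (n : ℕ),
    χ ((m : ℚ_[p]) / (p : ℚ_[p]) ^ n) =
      Complex.exp (2 * (Real.pi : ℂ) * Complex.I * (m : ℂ) / (p : ℂ) ^ n)

/-- The heat kernel `Z(x,t) = ∫_{ℚ_p⁴} χ(ξ·x) e^{−κ t |f°(ξ)|_p^α} d⁴ξ`. -/
def heatZ (μ : Measure (V p)) (χ : ℚ_[p] → ℂ) (a : ℤ) (κ α : ℝ) (x : V p) (t : ℝ) : ℂ :=
  ∫ ξ, χ (∑ i, ξ i * x i) * (Real.exp (-(κ * t * ‖qfc p a ξ‖ ^ α)) : ℂ) ∂μ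

/-- The pseudodifferential operator
`(f(∂,γ)φ)(x) = ((1 − p^γ)/(1 − p^{−γ−2})) ∫ (φ(x−y) − φ(x)) |f(y)|_p^{−γ−2} d⁴y`. -/
def fop (μ : Measure (V p)) (a : ℤ) (γ : ℝ) (φ : V p → ℂ) (x : V p) : ℂ :=
  (((1 - (p : ℝ) ^ γ) / (1 - (p : ℝ) ^ (-γ - 2)) : ℝ) : ℂ) *
    ∫ y, (φ (x - y) - φ x) * ((‖qf p a y‖ ^ (-γ - 2) : ℝ) : ℂ) ∂μ

/-- Membership in the domain of `f(∂,γ)`: `φ` is locally constant and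
`∫_{‖x‖_p ≥ p^m} |φ(x)| |f(x)|_p^{−γ−2} d⁴x < ∞` for some `m ∈ ℤ`. -/
def InDomain (μ : Measure (V p)) (a : ℤ) (γ : ℝ) (φ : V p → ℂ) : Prop :=
  IsLocallyConstant φ ∧ ∃ m : ℤ,
    IntegrableOn (fun x => ‖φ x‖ * ‖qf p a x‖ ^ (-γ - 2)) {x : V p | (p : ℝ) ^ m ≤ ‖x‖} μ

/-- The space `𝔐_λ` of locally constant functions `φ : ℚ_p⁴ → ℂ` with
`|φ(x)| ≤ C (1 + ‖x‖_p^λ)` for some constant `C`. -/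
def Mlam (lam : ℝ) (φ : V p → ℂ) : Prop :=
  IsLocallyConstant φ ∧ ∃ C : ℝ, ∀ x : V p, ‖φ x‖ ≤ C * (1 + ‖x‖ ^ lam)

/-- The potential `u₁(x,t) = ∫ Z(x − y, t) φ(y) d⁴y`. -/
def heatPot1 (μ : Measure (V p)) (χ : ℚ_[p] → ℂ) (a : ℤ) (κ α : ℝ)
    (φ : V p → ℂ) (x : V p) (t : ℝ) : ℂ :=
  ∫ y, heatZ p μ χ a κ α (x - y) t * φ y ∂μ

section Forms

variable {p}

lemma norm_intCast_eq_one_of_isQNR {a : ℤ} (ha : IsQNR p a) : ‖(a : ℚ_[p])‖ = 1 := by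
  refine le_antisymm (Padic.norm_int_le_one a) (not_lt.1 fun h => ?_)
  have hd := Padic.norm_intCast_lt_one_iff.1 h
  exact ha 0 (by rw [(ZMod.intCast_zmod_eq_zero_iff_dvd a p).2 hd]; simp)

/-- Reduction modulo `p` shows that `w² - a` is a unit for `w ∈ ℤ_p`. -/
lemma norm_sq_sub_intCast {a : ℤ} (ha : IsQNR p a) (w : ℚ_[p]) (hw : ‖w‖ ≤ 1) :
    ‖w ^ 2 - (a : ℚ_[p])‖ = 1 := by
  obtain ⟨z, rfl⟩ : ∃ z : ℤ_[p], (z : ℚ_[p]) = w := ⟨⟨w, hw⟩, rfl⟩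
  have hle : ‖z ^ 2 - (a : ℤ_[p])‖ = ‖(z : ℚ_[p]) ^ 2 - (a : ℚ_[p])‖ := by
    rw [PadicInt.norm_def]; push_cast; rfl
  rw [← hle]
  refine le_antisymm (PadicInt.norm_le_one _) (not_lt.1 fun h => ?_)
  have hm : z ^ 2 - (a : ℤ_[p]) ∈ RingHom.ker (PadicInt.toZMod (p := p)) := by
    rw [PadicInt.ker_toZMod, IsLocalRing.mem_maximalIdeal, PadicInt.mem_nonunits]
    exact h
  rw [RingHom.mem_ker, map_sub, map_pow, map_intCast, sub_eq_zero] at hm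
  exact ha _ hm

/-- The binary form `u² - a v²` is anisotropic, with norm the square of the max-norm. -/
lemma norm_sq_sub_mul_sq {a : ℤ} (ha : IsQNR p a) (u v : ℚ_[p]) :
    ‖u ^ 2 - (a : ℚ_[p]) * v ^ 2‖ = max ‖u‖ ‖v‖ ^ 2 := by
  rcases le_or_gt ‖u‖ ‖v‖ with h | h
  · rcases eq_or_ne v 0 with rfl | hv
    · have : u = 0 := by simpa using h
      simp [this]
    · have hv' : 0 < ‖v‖ := norm_pos_iff.2 hv
      have e : u ^ 2 - (a : ℚ_[p]) * v ^ 2 = v ^ 2 * ((u / v) ^ 2 - a) := by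
        field_simp
      rw [e, norm_mul, norm_sq_sub_intCast ha _ (by rw [norm_div]; exact (div_le_one hv').2 h),
        mul_one, norm_pow, max_eq_right h]
  · have hs : ‖v‖ ^ 2 < ‖u‖ ^ 2 := by gcongr
    have hn : ‖-((a : ℚ_[p]) * v ^ 2)‖ = ‖v‖ ^ 2 := by
      rw [norm_neg, norm_mul, norm_intCast_eq_one_of_isQNR ha, one_mul, norm_pow]
    have hne : ‖u ^ 2‖ ≠ ‖-((a : ℚ_[p]) * v ^ 2)‖ := by
      rw [hn, norm_pow]; exact hs.ne'
    rw [sub_eq_add_neg, IsUltrametricDist.norm_add_eq_max_of_norm_ne_norm hne, hn, norm_pow,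
      max_eq_left hs.le, max_eq_left h.le]

lemma one_lt_cast_prime : (1 : ℝ) < p := by exact_mod_cast (Fact.out : p.Prime).one_lt

/-- Squares of norms are even powers of `p`, so that they differ from `p⁻¹` times a square. -/
lemma sq_norm_ne_inv_mul_sq_norm {u v : ℚ_[p]} (h : u ≠ 0 ∨ v ≠ 0) :
    ‖u‖ ^ 2 ≠ (p : ℝ)⁻¹ * ‖v‖ ^ 2 := by
  have hp1 := one_lt_cast_prime (p := p)
  have hp0 : (0 : ℝ) < p := by linarith
  intro he
  rcases eq_or_ne u 0 with rfl | hu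
  · have hv : v ≠ 0 := by simpa using h
    have : 0 < (p : ℝ)⁻¹ * ‖v‖ ^ 2 := by positivity
    simp at he
    rcases he with he | he
    · exact (Fact.out : p.Prime).ne_zero he
    · exact hv he
  rcases eq_or_ne v 0 with rfl | hv
  · simp at he; exact hu he
  rw [Padic.norm_eq_zpow_neg_valuation hu, Padic.norm_eq_zpow_neg_valuation hv,
    ← zpow_natCast, ← zpow_natCast, ← zpow_mul, ← zpow_mul, ← zpow_neg_one,
    ← zpow_add₀ hp0.ne'] at he
  have := zpow_right_injective₀ hp0 hp1.ne' he
  push_cast at this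
  omega

lemma norm_le_max_pairs (x : V p) :
    ‖x‖ ≤ max (max ‖x 0‖ ‖x 1‖) (max ‖x 2‖ ‖x 3‖) := by
  refine (pi_norm_le_iff_of_nonneg (by positivity)).2 fun i => ?_
  fin_cases i <;> simp

/-- Lower bound for the quaternary form `(u² - a v²) - p (w² - a z²)`. -/
lemma le_norm_quaternary {a : ℤ} (ha : IsQNR p a) (u v w z : ℚ_[p]) :
    (p : ℝ)⁻¹ * max (max ‖u‖ ‖v‖) (max ‖w‖ ‖z‖) ^ 2 ≤
      ‖(u ^ 2 - (a : ℚ_[p]) * v ^ 2) - (p : ℚ_[p]) * (w ^ 2 - (a : ℚ_[p]) * z ^ 2)‖ := by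
  have hp1 := one_lt_cast_prime (p := p)
  have hp0 : (0 : ℝ) < p := by linarith
  obtain ⟨s, hs⟩ : ∃ s : ℚ_[p], ‖s‖ = max ‖u‖ ‖v‖ := by
    rcases max_choice ‖u‖ ‖v‖ with h | h
    exacts [⟨u, h.symm⟩, ⟨v, h.symm⟩]
  obtain ⟨r, hr⟩ : ∃ r : ℚ_[p], ‖r‖ = max ‖w‖ ‖z‖ := by
    rcases max_choice ‖w‖ ‖z‖ with h | h
    exacts [⟨w, h.symm⟩, ⟨z, h.symm⟩]
  rw [← hs, ← hr]
  by_cases h0 : s = 0 ∧ r = 0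
  · simp [h0.1, h0.2]
  have hA : ‖u ^ 2 - (a : ℚ_[p]) * v ^ 2‖ = ‖s‖ ^ 2 := by rw [norm_sq_sub_mul_sq ha, hs]
  have hB : ‖-((p : ℚ_[p]) * (w ^ 2 - (a : ℚ_[p]) * z ^ 2))‖ = (p : ℝ)⁻¹ * ‖r‖ ^ 2 := by
    rw [norm_neg, norm_mul, norm_sq_sub_mul_sq ha, hr, Padic.norm_p]
  have hne : ‖s‖ ^ 2 ≠ (p : ℝ)⁻¹ * ‖r‖ ^ 2 :=
    sq_norm_ne_inv_mul_sq_norm (by tauto)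
  rw [sub_eq_add_neg, IsUltrametricDist.norm_add_eq_max_of_norm_ne_norm (by rw [hA, hB]; exact hne),
    hA, hB]
  have hpi : (p : ℝ)⁻¹ ≤ 1 := inv_le_one_of_one_le₀ hp1.le
  rcases max_choice ‖s‖ ‖r‖ with h | h <;> rw [h]
  · exact le_max_of_le_left (mul_le_of_le_one_left (by positivity) hpi)
  · exact le_max_right _ _

lemma le_norm_qf {a : ℤ} (ha : IsQNR p a) (x : V p) : (p : ℝ)⁻¹ * ‖x‖ ^ 2 ≤ ‖qf p a x‖ := by
  have h := le_norm_quaternary ha (x 0) (x 1) (x 2) (x 3)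
  have e : qf p a x = (x 0 ^ 2 - (a : ℚ_[p]) * x 1 ^ 2)
      - (p : ℚ_[p]) * (x 2 ^ 2 - (a : ℚ_[p]) * x 3 ^ 2) := by unfold qf; ring
  rw [e]
  refine le_trans ?_ h
  gcongr
  exact norm_le_max_pairs x

lemma le_norm_qfc {a : ℤ} (ha : IsQNR p a) (x : V p) : (p : ℝ)⁻¹ * ‖x‖ ^ 2 ≤ ‖qfc p a x‖ := by
  have h := le_norm_quaternary ha (x 3) (x 2) (x 1) (x 0)
  have e : qfc p a x = (x 3 ^ 2 - (a : ℚ_[p]) * x 2 ^ 2)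
      - (p : ℚ_[p]) * (x 1 ^ 2 - (a : ℚ_[p]) * x 0 ^ 2) := by unfold qfc; ring
  rw [e]
  refine le_trans ?_ h
  gcongr
  rw [max_comm, max_comm ‖x 3‖, max_comm ‖x 1‖]
  exact norm_le_max_pairs x

lemma norm_add_four_le {x y z w : ℚ_[p]} {R : ℝ} (hx : ‖x‖ ≤ R) (hy : ‖y‖ ≤ R) (hz : ‖z‖ ≤ R)
    (hw : ‖w‖ ≤ R) : ‖x + y + z + w‖ ≤ R :=
  (IsUltrametricDist.norm_add_le_max _ _).trans (max_le
    ((IsUltrametricDist.norm_add_le_max _ _).trans (max_le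
      ((IsUltrametricDist.norm_add_le_max _ _).trans (max_le hx hy)) hz)) hw)

lemma norm_qfc_add_sub_le (a : ℤ) (x y : V p) {R : ℝ} (hR : ‖x‖ ≤ R) (hR' : ‖y‖ ≤ R) :
    ‖qfc p a (x + y) - qfc p a x‖ ≤ ‖y‖ * R := by
  have h2 : ‖(2 : ℚ_[p])‖ ≤ 1 := by exact_mod_cast Padic.norm_int_le_one (p := p) 2
  have hb : ∀ (c : ℤ) (i : Fin 4), ‖(c : ℚ_[p]) * (y i * (2 * x i + y i))‖ ≤ ‖y‖ * R := by
    intro c i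
    have hx := norm_le_pi_norm x i
    have hy := norm_le_pi_norm y i
    have h3 : ‖2 * x i + y i‖ ≤ R := by
      refine (IsUltrametricDist.norm_add_le_max _ _).trans (max_le ?_ (hy.trans hR'))
      rw [norm_mul]
      exact (mul_le_of_le_one_left (norm_nonneg _) h2).trans (hx.trans hR)
    rw [norm_mul, norm_mul]
    refine (mul_le_of_le_one_left (by positivity) (Padic.norm_int_le_one c)).trans ?_
    gcongr
  have e : qfc p a (x + y) - qfc p a x =
      ((a * p : ℤ) : ℚ_[p]) * (y 0 * (2 * x 0 + y 0))
      + ((-p : ℤ) : ℚ_[p]) * (y 1 * (2 * x 1 + y 1))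
      + ((-a : ℤ) : ℚ_[p]) * (y 2 * (2 * x 2 + y 2))
      + ((1 : ℤ) : ℚ_[p]) * (y 3 * (2 * x 3 + y 3)) := by
    simp only [qfc, Pi.add_apply]; push_cast; ring
  rw [e]
  exact norm_add_four_le (hb _ _) (hb _ _) (hb _ _) (hb _ _)

lemma norm_qfc_le (a : ℤ) (x : V p) : ‖qfc p a x‖ ≤ ‖x‖ ^ 2 := by
  have h := norm_qfc_add_sub_le a 0 x (R := ‖x‖) (by simp) le_rfl
  have h0 : qfc p a 0 = 0 := by simp [qfc]
  rw [h0, zero_add, sub_zero] at h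
  rwa [sq]

/-- The absolute value of `f°` is unchanged under perturbations small relative to the argument. -/
lemma norm_qfc_add {a : ℤ} (ha : IsQNR p a) {x y : V p} (h : (p : ℝ) ^ 2 * ‖y‖ ≤ ‖x‖) :
    ‖qfc p a (x + y)‖ = ‖qfc p a x‖ := by
  have hp1 := one_lt_cast_prime (p := p)
  have hp0 : (0 : ℝ) < p := by linarith
  rcases eq_or_ne x 0 with rfl | hx
  · have h1 : (p : ℝ) ^ 2 * ‖y‖ ≤ 0 := by simpa using h
    have h2 : ‖y‖ ≤ 0 := nonpos_of_mul_nonpos_right h1 (by positivity)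
    have h3 : y = 0 := norm_le_zero_iff.1 h2
    rw [h3, add_zero]
  have hx' : 0 < ‖x‖ := norm_pos_iff.2 hx
  have hyx : ‖y‖ ≤ ‖x‖ := by
    refine le_trans ?_ h
    exact le_mul_of_one_le_left (norm_nonneg _) (one_le_pow₀ hp1.le)
  have h1 : ‖qfc p a (x + y) - qfc p a x‖ < ‖qfc p a x‖ := by
    refine (norm_qfc_add_sub_le a x y le_rfl hyx).trans_lt (lt_of_lt_of_le ?_ (le_norm_qfc ha x))
    have : ‖y‖ < (p : ℝ)⁻¹ * ‖x‖ := by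
      rw [lt_inv_mul_iff₀ hp0]
      refine lt_of_mul_lt_mul_left ?_ hp0.le
      calc (p : ℝ) * (p * ‖y‖) = (p : ℝ) ^ 2 * ‖y‖ := by ring
        _ ≤ ‖x‖ := h
        _ < p * ‖x‖ := lt_mul_of_one_lt_left hx' hp1
    calc ‖y‖ * ‖x‖ < (p : ℝ)⁻¹ * ‖x‖ * ‖x‖ := by gcongr
      _ = _ := by ring
  have e : qfc p a (x + y) = (qfc p a (x + y) - qfc p a x) + qfc p a x := by ring
  rw [e, IsUltrametricDist.norm_add_eq_max_of_norm_ne_norm h1.ne, max_eq_right h1.le]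

lemma continuous_qf (a : ℤ) : Continuous (qf p a) := by unfold qf; fun_prop

lemma continuous_qfc (a : ℤ) : Continuous (qfc p a) := by unfold qfc; fun_prop

end Forms

section StdChar

variable {p} {χ : ℚ_[p] → ℂ}

/-- The ring `ℤ[1/p]` is dense in `ℚ_p`. -/
lemma denseRange_intCast_div_pow :
    DenseRange (fun q : ℤ × ℕ => (q.1 : ℚ_[p]) / (p : ℚ_[p]) ^ q.2) := by
  have hp0 : (p : ℚ_[p]) ≠ 0 := by exact_mod_cast (Fact.out : p.Prime).ne_zero
  intro x
  obtain ⟨n, hn⟩ : ∃ n : ℕ, ‖x * (p : ℚ_[p]) ^ n‖ ≤ 1 := by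
    obtain ⟨n, hn⟩ := pow_unbounded_of_one_lt ‖x‖ (one_lt_cast_prime (p := p))
    refine ⟨n, ?_⟩
    rw [norm_mul, norm_pow, Padic.norm_p, inv_pow]
    exact mul_inv_le_one_of_le₀ hn.le (by positivity)
  let z : ℤ_[p] := ⟨_, hn⟩
  let F : ℤ_[p] → ℚ_[p] := fun w => (w : ℚ_[p]) / (p : ℚ_[p]) ^ n
  have hF : Continuous F := by fun_prop
  have hz : F z = x := by simp only [F, z]; field_simp
  rw [← hz]
  refine closure_mono ?_ (image_closure_subset_closure_image hF
    ⟨z, PadicInt.denseRange_intCast z, rfl⟩)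
  rintro _ ⟨_, ⟨m, rfl⟩, rfl⟩
  exact ⟨(m, n), by simp [F]⟩

lemma IsStdChar.norm_eq_one (hχ : IsStdChar p χ) (x : ℚ_[p]) : ‖χ x‖ = 1 := by
  refine congrFun (denseRange_intCast_div_pow.equalizer (g := fun x => ‖χ x‖) (h := fun _ => 1)
    hχ.1.norm continuous_const ?_) x
  ext ⟨m, n⟩
  have e : 2 * (Real.pi : ℂ) * Complex.I * (m : ℂ) / (p : ℂ) ^ n
      = ((2 * Real.pi * m / (p : ℝ) ^ n : ℝ) : ℂ) * Complex.I := by push_cast; ring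
  simp only [Function.comp_apply]
  rw [hχ.2, e, Complex.norm_exp_ofReal_mul_I]

lemma IsStdChar.map_add (hχ : IsStdChar p χ) (x y : ℚ_[p]) : χ (x + y) = χ x * χ y := by
  have hp0 : (p : ℚ_[p]) ≠ 0 := by exact_mod_cast (Fact.out : p.Prime).ne_zero
  have hpC : (p : ℂ) ≠ 0 := by exact_mod_cast (Fact.out : p.Prime).ne_zero
  have hd := (denseRange_intCast_div_pow (p := p)).prodMap (denseRange_intCast_div_pow (p := p))
  have hc := hχ.1
  refine congrFun (hd.equalizer (g := fun q : ℚ_[p] × ℚ_[p] => χ (q.1 + q.2))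
    (h := fun q => χ q.1 * χ q.2) (by fun_prop) (by fun_prop) ?_) (x, y)
  ext ⟨⟨m, n⟩, ⟨k, l⟩⟩
  simp only [Function.comp_apply, Prod.map]
  have e : (m : ℚ_[p]) / (p : ℚ_[p]) ^ n + (k : ℚ_[p]) / (p : ℚ_[p]) ^ l
      = ((m * p ^ l + k * p ^ n : ℤ) : ℚ_[p]) / (p : ℚ_[p]) ^ (n + l) := by
    push_cast; field_simp; ring
  rw [e, hχ.2, hχ.2, hχ.2, ← Complex.exp_add]
  congr 1
  push_cast
  field_simp
  ring

lemma IsStdChar.map_zero (hχ : IsStdChar p χ) : χ 0 = 1 := by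
  simpa using hχ.2 0 0

lemma IsStdChar.eq_one_of_norm_le_one (hχ : IsStdChar p χ) {x : ℚ_[p]} (hx : ‖x‖ ≤ 1) :
    χ x = 1 := by
  have hc := hχ.1
  have h := congrFun (PadicInt.denseRange_intCast.equalizer (g := fun z : ℤ_[p] => χ z)
    (h := fun _ => 1) (by fun_prop) continuous_const ?_) ⟨x, hx⟩
  · exact h
  ext m
  have := hχ.2 m 0
  simp only [pow_zero, div_one] at this
  simp only [Function.comp_apply, PadicInt.coe_intCast, this]
  rw [mul_comm]
  exact Complex.exp_int_mul_two_pi_mul_I m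

lemma IsStdChar.inv_prime_ne_one (hχ : IsStdChar p χ) : χ ((p : ℚ_[p])⁻¹) ≠ 1 := by
  have h := hχ.2 1 1
  simp only [Int.cast_one, pow_one, one_div, mul_one] at h
  rw [h]
  intro h1
  have hp := (Fact.out : p.Prime)
  exact (Complex.isPrimitiveRoot_exp p hp.ne_zero).ne_one hp.one_lt h1

end StdChar

section RadialIntegrals

variable {p} {μ : Measure (V p)} [μ.IsAddHaarMeasure]

/-- Every point of the ball of radius `p^(n+1)` lies within `p^n` of one of `p⁴` centres. -/
lemma measure_closedBall_prime_pow_succ_le (n : ℕ) :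
    μ (Metric.closedBall 0 ((p : ℝ) ^ (n + 1))) ≤
      (p : ENNReal) ^ 4 * μ (Metric.closedBall 0 ((p : ℝ) ^ n)) := by
  have hp0 : (p : ℚ_[p]) ≠ 0 := by exact_mod_cast (Fact.out : p.Prime).ne_zero
  have hpR : (0 : ℝ) < p := zero_lt_one.trans one_lt_cast_prime
  let c : (Fin 4 → Fin p) → V p := fun k i => ((k i : ℕ) : ℚ_[p]) / (p : ℚ_[p]) ^ (n + 1)
  have hsub : Metric.closedBall (0 : V p) ((p : ℝ) ^ (n + 1)) ⊆
      ⋃ k, Metric.closedBall (c k) ((p : ℝ) ^ n) := by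
    intro x hx
    rw [mem_closedBall_zero_iff] at hx
    have hxi : ∀ i, ‖x i * (p : ℚ_[p]) ^ (n + 1)‖ ≤ 1 := fun i => by
      rw [norm_mul, norm_pow, Padic.norm_p, inv_pow]
      exact mul_inv_le_one_of_le₀ ((norm_le_pi_norm x i).trans hx) (by positivity)
    let z : Fin 4 → ℤ_[p] := fun i => ⟨_, hxi i⟩
    refine mem_iUnion.2 ⟨fun i => ⟨(z i).zmodRepr, PadicInt.zmodRepr_lt_p _⟩, ?_⟩
    rw [mem_closedBall_iff_norm, pi_norm_le_iff_of_nonneg (by positivity)]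
    intro i
    have h1 : ‖z i - ((z i).zmodRepr : ℤ_[p])‖ ≤ (p : ℝ) ^ (-1 : ℤ) := by
      have := PadicInt.norm_sub_zmodRepr_lt_one (z i)
      rw [PadicInt.norm_le_pow_iff_norm_lt_pow_add_one]
      simpa using this
    rw [PadicInt.norm_def] at h1
    push_cast at h1
    have e : (x - c fun i => ⟨(z i).zmodRepr, PadicInt.zmodRepr_lt_p _⟩) i
        = ((z i : ℚ_[p]) - ((z i).zmodRepr : ℚ_[p])) / (p : ℚ_[p]) ^ (n + 1) := by
      simp only [Pi.sub_apply, c, z]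
      field_simp
    rw [e, norm_div, norm_pow, Padic.norm_p]
    calc _ ≤ (p : ℝ) ^ (-1 : ℤ) / (p : ℝ)⁻¹ ^ (n + 1) := by gcongr
      _ = (p : ℝ) ^ n := by 
        rw [zpow_neg_one, inv_pow, pow_succ]; field_simp
  refine (measure_mono hsub).trans ((measure_iUnion_fintype_le _ _).trans ?_)
  have hball : ∀ k, μ (Metric.closedBall (c k) ((p : ℝ) ^ n))
      = μ (Metric.closedBall 0 ((p : ℝ) ^ n)) := fun k =>
    Measure.addHaar_closedBall_center μ _ _
  simp [hball]

lemma measure_closedBall_prime_pow_le (n : ℕ) :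
    μ (Metric.closedBall 0 ((p : ℝ) ^ n)) ≤
      ((p : ENNReal) ^ 4) ^ n * μ (Metric.closedBall 0 1) := by
  induction n with
  | zero => simp
  | succ n ih =>
    refine (measure_closedBall_prime_pow_succ_le n).trans ?_
    rw [pow_succ' _ n, mul_assoc]
    gcongr

lemma prime_pow_mul_measure_closedBall_le (n : ℕ) :
    (p : ENNReal) ^ 4 * μ (Metric.closedBall 0 ((p : ℝ)⁻¹ ^ (n + 1))) ≤
      μ (Metric.closedBall 0 ((p : ℝ)⁻¹ ^ n)) := by
  have hp0 : (p : ℚ_[p]) ≠ 0 := by exact_mod_cast (Fact.out : p.Prime).ne_zero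
  have hp1 := one_lt_cast_prime (p := p)
  have hpR : (0 : ℝ) < p := zero_lt_one.trans hp1
  have hpi : (p : ℝ)⁻¹ < 1 := inv_lt_one_of_one_lt₀ hp1
  let c : (Fin 4 → Fin p) → V p := fun k i => ((k i : ℕ) : ℚ_[p]) * (p : ℚ_[p]) ^ n
  have hdisj : Pairwise (Function.onFun Disjoint
      fun k => Metric.closedBall (c k) ((p : ℝ)⁻¹ ^ (n + 1))) := by
    intro k l hkl
    obtain ⟨i, hi⟩ := Function.ne_iff.1 hkl
    refine Set.disjoint_left.2 fun x hx hy => ?_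
    have h1 : ‖c k i - c l i‖ ≤ (p : ℝ)⁻¹ ^ (n + 1) := by
      have h2 : ‖c k - c l‖ ≤ (p : ℝ)⁻¹ ^ (n + 1) := by
        have e : c k - c l = (c k - x) + (x - c l) := by abel
        rw [e]
        exact (IsUltrametricDist.norm_add_le_max _ _).trans
          (max_le (mem_closedBall_iff_norm'.1 hx) (mem_closedBall_iff_norm.1 hy))
      exact (norm_le_pi_norm (c k - c l) i).trans h2
    have e : c k i - c l i = (((k i : ℕ) - (l i : ℕ) : ℤ) : ℚ_[p]) * (p : ℚ_[p]) ^ n := by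
      simp only [c]; push_cast; ring
    rw [e, norm_mul, norm_pow, Padic.norm_p, pow_succ', mul_le_mul_iff_left₀ (by positivity)] at h1
    have hd := Padic.norm_intCast_lt_one_iff.1 (h1.trans_lt hpi)
    have hk := (k i).isLt
    have hl := (l i).isLt
    have h0 := Int.eq_zero_of_abs_lt_dvd hd (by rw [abs_lt]; constructor <;> omega)
    exact hi (Fin.ext (by omega))
  have hsub : (⋃ k, Metric.closedBall (c k) ((p : ℝ)⁻¹ ^ (n + 1))) ⊆
      Metric.closedBall (0 : V p) ((p : ℝ)⁻¹ ^ n) := by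
    refine iUnion_subset fun k x hx => ?_
    rw [mem_closedBall_zero_iff]
    have hc : ‖c k‖ ≤ (p : ℝ)⁻¹ ^ n := by
      refine (pi_norm_le_iff_of_nonneg (by positivity)).2 fun i => ?_
      simp only [c]
      rw [norm_mul, norm_pow, Padic.norm_p]
      refine mul_le_of_le_one_left (by positivity) ?_
      exact_mod_cast Padic.norm_int_le_one (p := p) (k i : ℕ)
    have e : x = (x - c k) + c k := by abel
    rw [e]
    refine (IsUltrametricDist.norm_add_le_max _ _).trans
      (max_le ((mem_closedBall_iff_norm.1 hx).trans ?_) hc)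
    exact pow_le_pow_of_le_one (by positivity) hpi.le n.le_succ
  refine le_trans (le_of_eq ?_) (measure_mono hsub)
  rw [measure_iUnion hdisj fun k => Metric.isClosed_closedBall.measurableSet]
  have hball : ∀ k, μ (Metric.closedBall (c k) ((p : ℝ)⁻¹ ^ (n + 1)))
      = μ (Metric.closedBall 0 ((p : ℝ)⁻¹ ^ (n + 1))) := fun k =>
    Measure.addHaar_closedBall_center μ _ _
  rw [tsum_fintype, Finset.sum_congr rfl fun k _ => hball k]
  simp

lemma measure_closedBall_inv_prime_pow_le (n : ℕ) :
    ((p : ENNReal) ^ 4) ^ n * μ (Metric.closedBall 0 ((p : ℝ)⁻¹ ^ n)) ≤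
      μ (Metric.closedBall 0 1) := by
  induction n with
  | zero => simp
  | succ n ih =>
    refine le_trans ?_ ih
    rw [pow_succ, mul_assoc]
    gcongr
    exact prime_pow_mul_measure_closedBall_le n

lemma measureReal_closedBall_le {R : ℝ} (hR0 : 0 < R) (hR1 : R ≤ 1) :
    μ.real (Metric.closedBall 0 R) ≤ (p : ℝ) ^ 4 * μ.real (Metric.closedBall 0 1) * R ^ 4 := by
  have hp1 := one_lt_cast_prime (p := p)
  have hpR : (0 : ℝ) < p := zero_lt_one.trans hp1
  obtain ⟨n, hn1, hn2⟩ := exists_nat_pow_near (x := R⁻¹) ((one_le_inv₀ hR0).2 hR1) hp1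
  have hRn : R ≤ (p : ℝ)⁻¹ ^ n := by
    rw [inv_pow, le_inv_comm₀ hR0 (by positivity)]; exact hn1
  have hfin : ∀ r, μ (Metric.closedBall (0 : V p) r) ≠ ⊤ := fun r =>
    (isCompact_closedBall _ _).measure_lt_top.ne
  have h1 : ((p : ℝ) ^ 4) ^ n * μ.real (Metric.closedBall 0 ((p : ℝ)⁻¹ ^ n)) ≤
      μ.real (Metric.closedBall 0 1) := by
    have := ENNReal.toReal_mono (hfin _) (measure_closedBall_inv_prime_pow_le (μ := μ) n)
    simpa [ENNReal.toReal_mul, Measure.real] using this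
  have h2 : μ.real (Metric.closedBall (0 : V p) R) ≤ μ.real (Metric.closedBall 0 ((p : ℝ)⁻¹ ^ n)) :=
    measureReal_mono (Metric.closedBall_subset_closedBall hRn) (hfin _)
  have h3 : (1 : ℝ) ≤ (p * R) ^ 4 * ((p : ℝ) ^ 4) ^ n := by
    have h4 : 1 ≤ p * R * (p : ℝ) ^ n := by
      rw [inv_lt_iff_one_lt_mul₀ hR0] at hn2
      calc (1 : ℝ) ≤ (p : ℝ) ^ (n + 1) * R := hn2.le
        _ = _ := by ring
    calc (1 : ℝ) ≤ (p * R * (p : ℝ) ^ n) ^ 4 := one_le_pow₀ h4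
      _ = _ := by ring
  calc _ ≤ μ.real (Metric.closedBall (0 : V p) ((p : ℝ)⁻¹ ^ n)) := h2
    _ ≤ (p * R) ^ 4 * ((p : ℝ) ^ 4) ^ n * μ.real (Metric.closedBall (0 : V p) ((p : ℝ)⁻¹ ^ n)) :=
        le_mul_of_one_le_left measureReal_nonneg h3
    _ = (p * R) ^ 4 * (((p : ℝ) ^ 4) ^ n * μ.real (Metric.closedBall (0 : V p) ((p : ℝ)⁻¹ ^ n))) := by
        ring
    _ ≤ (p * R) ^ 4 * μ.real (Metric.closedBall 0 1) := by gcongr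
    _ = _ := by ring

lemma integrable_one_add_norm_rpow {s : ℝ} (hs : 4 < s) :
    Integrable (fun x : V p => (1 + ‖x‖) ^ (-s)) μ := by
  have hp1 := one_lt_cast_prime (p := p)
  have hpR : (0 : ℝ) < p := zero_lt_one.trans hp1
  have hpos : ∀ x : V p, 0 < 1 + ‖x‖ := fun x => by positivity
  have hcont : Continuous (fun x : V p => (1 + ‖x‖) ^ (-s)) :=
    Continuous.rpow_const (by fun_prop) fun x => Or.inl (hpos x).ne'
  refine ⟨hcont.aestronglyMeasurable, ?_⟩
  rw [hasFiniteIntegral_iff_ofReal (Eventually.of_forall fun x => by positivity)]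
  let B : ℕ → Set (V p) := fun n => Metric.closedBall 0 ((p : ℝ) ^ (n + 1))
  let c : ℕ → ENNReal := fun n => ENNReal.ofReal (((p : ℝ) ^ (-s)) ^ n)
  have hle : ∀ x : V p, ENNReal.ofReal ((1 + ‖x‖) ^ (-s)) ≤
      ∑' n, (B n).indicator (fun _ => c n) x := by
    intro x
    obtain ⟨n, hn1, hn2⟩ := exists_nat_pow_near (x := 1 + ‖x‖) (by simp) hp1
    have hx : x ∈ B n := by
      rw [mem_closedBall_zero_iff]; linarith
    refine le_trans ?_ (ENNReal.le_tsum n)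
    rw [indicator_of_mem hx]
    refine ENNReal.ofReal_le_ofReal ?_
    rw [← Real.rpow_natCast, ← Real.rpow_mul hpR.le, mul_comm, Real.rpow_mul hpR.le,
      Real.rpow_natCast]
    exact Real.rpow_le_rpow_of_nonpos (by positivity) hn1 (by linarith)
  set r : ENNReal := ENNReal.ofReal ((p : ℝ) ^ (4 - s)) with hr
  have hr1 : r < 1 := by
    rw [hr, ENNReal.ofReal_lt_one]
    exact Real.rpow_lt_one_of_one_lt_of_neg hp1 (by linarith)
  set M := (p : ENNReal) ^ 4 * μ (Metric.closedBall (0 : V p) 1) with hM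
  have hMtop : M ≠ ⊤ := ENNReal.mul_ne_top (ENNReal.pow_ne_top (ENNReal.natCast_ne_top p))
    (isCompact_closedBall _ _).measure_lt_top.ne
  have hterm : ∀ n, c n * μ (B n) ≤ M * r ^ n := by
    intro n
    have hrn : c n * ((p : ENNReal) ^ 4) ^ n = r ^ n := by
      simp only [c, hr]
      have : (p : ENNReal) = ENNReal.ofReal p := (ENNReal.ofReal_natCast p).symm
      rw [this, ← ENNReal.ofReal_pow hpR.le, ENNReal.ofReal_pow (by positivity), ← mul_pow,
        ← ENNReal.ofReal_mul (by positivity), ← Real.rpow_natCast (p : ℝ) 4,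
        ← Real.rpow_add hpR]
      congr 3
      push_cast; ring
    calc c n * μ (B n) ≤ c n * (((p : ENNReal) ^ 4) ^ (n + 1) * μ (Metric.closedBall 0 1)) := by
          gcongr; exact measure_closedBall_prime_pow_le (n + 1)
      _ = M * (c n * ((p : ENNReal) ^ 4) ^ n) := by rw [hM, pow_succ]; ring
      _ = M * r ^ n := by rw [hrn]
  calc ∫⁻ x, ENNReal.ofReal ((1 + ‖x‖) ^ (-s)) ∂μ
      ≤ ∫⁻ x, ∑' n, (B n).indicator (fun _ => c n) x ∂μ := lintegral_mono hle
    _ = ∑' n, c n * μ (B n) := by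
        rw [lintegral_tsum fun n => (measurable_const.indicator
          Metric.isClosed_closedBall.measurableSet).aemeasurable]
        congr 1; ext n
        rw [lintegral_indicator_const Metric.isClosed_closedBall.measurableSet]
    _ ≤ ∑' n, M * r ^ n := ENNReal.tsum_le_tsum hterm
    _ = M * (1 - r)⁻¹ := by rw [ENNReal.tsum_mul_left, ENNReal.tsum_geometric]
    _ < ⊤ := ENNReal.mul_lt_top hMtop.lt_top
        (ENNReal.inv_lt_top.2 (tsub_pos_of_lt hr1))

/-- The heat symbol decays faster than any power. -/
lemma exists_exp_neg_norm_qfc_le {a : ℤ} (ha : IsQNR p a) {c α : ℝ} (hc : 0 < c) (hα : 0 < α)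
    {s : ℝ} (hs : 0 ≤ s) :
    ∃ C : ℝ, 0 ≤ C ∧ ∀ ξ : V p,
      Real.exp (-(c * ‖qfc p a ξ‖ ^ α)) ≤ C * (1 + ‖ξ‖) ^ (-s) := by
  have hpR : (0 : ℝ) < p := zero_lt_one.trans one_lt_cast_prime
  obtain ⟨n, hn⟩ := exists_nat_ge (s / (2 * α))
  rw [div_le_iff₀ (by positivity)] at hn
  set d : ℝ := c * (p : ℝ)⁻¹ ^ α with hd
  have hd0 : 0 < d := by positivity
  refine ⟨2 ^ s * (1 + n.factorial / d ^ n), by positivity, fun ξ => ?_⟩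
  set r := ‖ξ‖ with hr
  have hr0 : 0 ≤ r := norm_nonneg _
  set x := c * ‖qfc p a ξ‖ ^ α with hx
  have hx0 : 0 ≤ x := by positivity
  have hdx : d * r ^ (2 * α) ≤ x := by
    have h1 : ((p : ℝ)⁻¹ * r ^ 2) ^ α ≤ ‖qfc p a ξ‖ ^ α :=
      Real.rpow_le_rpow (by positivity) (le_norm_qfc ha ξ) hα.le
    rw [Real.mul_rpow (by positivity) (by positivity), ← Real.rpow_natCast r 2,
      ← Real.rpow_mul hr0] at h1
    rw [hd, hx, mul_assoc]
    exact mul_le_mul_of_nonneg_left (by exact_mod_cast h1) hc.le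
  have hpow : r ^ (n * (2 * α)) ≤ n.factorial / d ^ n * Real.exp x := by
    have h1 : (d * r ^ (2 * α)) ^ n ≤ n.factorial * Real.exp x := by
      have h2 := Real.pow_div_factorial_le_exp x hx0 n
      rw [div_le_iff₀ (by positivity)] at h2
      rw [mul_comm (n.factorial : ℝ)]
      exact (pow_le_pow_left₀ (by positivity) hdx n).trans h2
    rw [mul_pow, ← Real.rpow_natCast (r ^ (2 * α)), ← Real.rpow_mul hr0] at h1
    rw [mul_comm (n : ℝ), div_mul_eq_mul_div, le_div_iff₀ (by positivity), mul_comm]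
    exact h1
  have h1r : (1 + r) ^ s ≤ 2 ^ s * (1 + r ^ (n * (2 * α))) := by
    rcases le_total r 1 with h | h
    · calc (1 + r) ^ s ≤ 2 ^ s := Real.rpow_le_rpow (by positivity) (by linarith) hs
        _ ≤ _ := le_mul_of_one_le_right (by positivity) (by
          have : 0 ≤ r ^ (n * (2 * α)) := by positivity
          linarith)
    · calc (1 + r) ^ s ≤ (2 * r) ^ s := Real.rpow_le_rpow (by positivity) (by linarith) hs
        _ = 2 ^ s * r ^ s := Real.mul_rpow (by norm_num) hr0
        _ ≤ 2 ^ s * r ^ (n * (2 * α)) := by gcongr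
        _ ≤ _ := by gcongr; linarith
  have hex : 1 ≤ Real.exp x := Real.one_le_exp hx0
  have hmain : (1 + r) ^ s ≤ 2 ^ s * (1 + n.factorial / d ^ n) * Real.exp x := by
    refine h1r.trans ?_
    rw [mul_assoc]
    gcongr
    rw [add_mul, one_mul]
    exact add_le_add hex hpow
  rw [Real.exp_neg, Real.rpow_neg (by positivity), ← div_eq_mul_inv, le_div_iff₀ (by positivity),
    inv_mul_le_iff₀ (by positivity), mul_comm]
  exact hmain

end RadialIntegrals

section HeatKernel

variable {p} {μ : Measure (V p)} [μ.IsAddHaarMeasure] {χ : ℚ_[p] → ℂ}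

/-- The Fourier multiplier `e^{−κ t |f°(ξ)|_p^α}`. -/
def heatSymbol (a : ℤ) (κ α t : ℝ) (ξ : V p) : ℝ :=
  Real.exp (-(κ * t * ‖qfc p a ξ‖ ^ α))

omit [μ.IsAddHaarMeasure] in
lemma heatZ_eq_integral_heatSymbol (a : ℤ) (κ α t : ℝ) (x : V p) :
    heatZ p μ χ a κ α x t = ∫ ξ, χ (∑ i, ξ i * x i) * (heatSymbol a κ α t ξ : ℂ) ∂μ := rfl

lemma heatSymbol_pos (a : ℤ) (κ α t : ℝ) (ξ : V p) : 0 < heatSymbol a κ α t ξ := Real.exp_pos _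

lemma norm_heatSymbol (a : ℤ) (κ α t : ℝ) (ξ : V p) :
    ‖(heatSymbol a κ α t ξ : ℂ)‖ = heatSymbol a κ α t ξ := by
  rw [Complex.norm_real, Real.norm_of_nonneg (heatSymbol_pos ..).le]

lemma continuous_heatSymbol (a : ℤ) (κ t : ℝ) {α : ℝ} (hα : 0 < α) :
    Continuous (heatSymbol (p := p) a κ α t) := by
  have h := (continuous_qfc (p := p) a).norm.rpow_const (p := α) fun _ => Or.inr hα.le
  unfold heatSymbol
  fun_prop

lemma norm_sum_mul_le (ξ x : V p) : ‖∑ i, ξ i * x i‖ ≤ ‖ξ‖ * ‖x‖ := by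
  rw [Fin.sum_univ_four]
  have h : ∀ i, ‖ξ i * x i‖ ≤ ‖ξ‖ * ‖x‖ := fun i => by
    rw [norm_mul]
    exact mul_le_mul (norm_le_pi_norm ξ i) (norm_le_pi_norm x i) (norm_nonneg _) (norm_nonneg _)
  exact norm_add_four_le (h 0) (h 1) (h 2) (h 3)

lemma IsStdChar.sum_add_left (hχ : IsStdChar p χ) (ξ η x : V p) :
    χ (∑ i, (ξ + η) i * x i) = χ (∑ i, ξ i * x i) * χ (∑ i, η i * x i) := by
  rw [← hχ.map_add]; simp [add_mul, Finset.sum_add_distrib]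

lemma IsStdChar.sum_add_right (hχ : IsStdChar p χ) (ξ x y : V p) :
    χ (∑ i, ξ i * (x + y) i) = χ (∑ i, ξ i * x i) * χ (∑ i, ξ i * y i) := by
  rw [← hχ.map_add]; simp [mul_add, Finset.sum_add_distrib]

lemma exists_sum_mul_eq_inv_prime {x : V p} (hx : x ≠ 0) :
    ∃ η : V p, ∑ i, η i * x i = (p : ℚ_[p])⁻¹ ∧ ‖η‖ * ‖x‖ = p := by
  have hx0 : 0 < ‖x‖ := norm_pos_iff.2 hx
  obtain ⟨i, hi⟩ : ∃ i, ‖x‖ = ‖x i‖ := by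
    obtain ⟨i, -, hi⟩ := Finset.exists_mem_eq_sup' (s := (Finset.univ : Finset (Fin 4)))
      Finset.univ_nonempty fun i => ‖x i‖₊
    refine ⟨i, ?_⟩
    rw [Pi.norm_def, ← Finset.sup'_eq_sup Finset.univ_nonempty, hi]; rfl
  have hxi : x i ≠ 0 := by
    rw [← norm_pos_iff, ← hi]; exact hx0
  refine ⟨Pi.single i ((p : ℚ_[p])⁻¹ * (x i)⁻¹), ?_, ?_⟩
  · rw [Finset.sum_eq_single i]
    · simp [hxi]
    · intro j _ hj; simp [Pi.single_eq_of_ne hj]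
    · simp
  · rw [Pi.norm_single, norm_mul, norm_inv, norm_inv, Padic.norm_p, inv_inv, ← hi]
    field_simp

section Symbol

variable {a : ℤ} (ha : IsQNR p a) {κ α t : ℝ} (hκ : 0 < κ) (hα : 0 < α) (ht : 0 < t)
include ha hκ hα ht

lemma integrable_norm_rpow_mul_heatSymbol {M : ℝ} (hM : 0 ≤ M) :
    Integrable (fun ξ : V p => ‖ξ‖ ^ M * heatSymbol a κ α t ξ) μ := by
  obtain ⟨C, hC0, hC⟩ := exists_exp_neg_norm_qfc_le (p := p) ha (mul_pos hκ ht) hα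
    (s := M + 5) (by linarith)
  have hc := continuous_heatSymbol (p := p) a κ t hα
  have hn : Continuous fun ξ : V p => ‖ξ‖ ^ M := continuous_norm.rpow_const fun _ => Or.inr hM
  refine ((integrable_one_add_norm_rpow (μ := μ) (s := 5) (by norm_num)).const_mul C).mono'
    (hn.mul hc).aestronglyMeasurable (Eventually.of_forall fun ξ => ?_)
  have h0 : (0 : ℝ) < 1 + ‖ξ‖ := by positivity
  rw [Real.norm_of_nonneg (mul_nonneg (by positivity) (heatSymbol_pos ..).le)]
  calc ‖ξ‖ ^ M * heatSymbol a κ α t ξ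
      ≤ (1 + ‖ξ‖) ^ M * (C * (1 + ‖ξ‖) ^ (-(M + 5))) := by
        refine mul_le_mul (Real.rpow_le_rpow (norm_nonneg _) (by linarith) hM) (hC ξ)
          (heatSymbol_pos ..).le (by positivity)
    _ = C * (1 + ‖ξ‖) ^ (-5 : ℝ) := by
        rw [mul_left_comm, ← Real.rpow_add h0]; congr 2; ring

lemma integrable_heatSymbol : Integrable (heatSymbol (p := p) a κ α t) μ := by
  simpa using integrable_norm_rpow_mul_heatSymbol (μ := μ) ha hκ hα ht (le_refl 0)

lemma integrable_char_mul_heatSymbol (hχ : IsStdChar p χ) (x : V p) :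
    Integrable (fun ξ : V p => χ (∑ i, ξ i * x i) * (heatSymbol a κ α t ξ : ℂ)) μ := by
  have hc := hχ.1
  refine Integrable.bdd_mul (c := 1) (integrable_heatSymbol ha hκ hα ht).ofReal
    (Continuous.aestronglyMeasurable (by fun_prop))
    (Eventually.of_forall fun ξ => (hχ.norm_eq_one _).le)

lemma continuous_heatZ (hχ : IsStdChar p χ) :
    Continuous fun x => heatZ p μ χ a κ α x t := by
  have hc := hχ.1
  refine continuous_of_dominated (bound := heatSymbol a κ α t)
    (fun x => (integrable_char_mul_heatSymbol ha hκ hα ht hχ x).aestronglyMeasurable)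
    (fun x => Eventually.of_forall fun ξ => ?_) (integrable_heatSymbol ha hκ hα ht)
    (Eventually.of_forall fun ξ => by fun_prop)
  rw [norm_mul, hχ.norm_eq_one, one_mul]
  exact (norm_heatSymbol ..).le

lemma norm_heatZ_le (hχ : IsStdChar p χ) (x : V p) :
    ‖heatZ p μ χ a κ α x t‖ ≤ ∫ ξ, heatSymbol a κ α t ξ ∂μ := by
  refine norm_integral_le_of_norm_le (integrable_heatSymbol ha hκ hα ht)
    (Eventually.of_forall fun ξ => ?_)
  rw [norm_mul, hχ.norm_eq_one, one_mul]
  exact (norm_heatSymbol ..).le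

omit hκ hα ht in
lemma heatSymbol_add {ξ η : V p} (h : (p : ℝ) ^ 2 * ‖η‖ ≤ ‖ξ‖) :
    heatSymbol a κ α t (ξ + η) = heatSymbol a κ α t ξ := by
  rw [heatSymbol, norm_qfc_add ha h, heatSymbol]

/-- Away from the origin, the heat kernel is locally constant at the scale of its argument. -/
lemma heatZ_add (hχ : IsStdChar p χ) {x h : V p} (hh : (p : ℝ) ^ 3 * ‖h‖ ≤ ‖x‖) :
    heatZ p μ χ a κ α (x + h) t = heatZ p μ χ a κ α x t := by
  have hp1 := one_lt_cast_prime (p := p)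
  have hp0 : (0 : ℝ) < p := zero_lt_one.trans hp1
  rcases eq_or_ne x 0 with rfl | hx
  · have h1 : (p : ℝ) ^ 3 * ‖h‖ ≤ 0 := by simpa using hh
    have h2 : ‖h‖ ≤ 0 := nonpos_of_mul_nonpos_right h1 (by positivity)
    rw [norm_le_zero_iff.1 h2, add_zero]
  have hx0 : 0 < ‖x‖ := norm_pos_iff.2 hx
  obtain ⟨η, hη, hηx⟩ := exists_sum_mul_eq_inv_prime hx
  have hηh : χ (∑ i, η i * h i) = 1 := by
    refine hχ.eq_one_of_norm_le_one ((norm_sum_mul_le η h).trans ?_)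
    have h3 : (p : ℝ) ^ 3 * (‖η‖ * ‖h‖) ≤ p := by
      calc (p : ℝ) ^ 3 * (‖η‖ * ‖h‖) = ‖η‖ * ((p : ℝ) ^ 3 * ‖h‖) := by ring
        _ ≤ ‖η‖ * ‖x‖ := by gcongr
        _ = p := hηx
    refine le_of_mul_le_mul_left (h3.trans ?_) (pow_pos hp0 3)
    rw [mul_one]
    exact le_self_pow₀ hp1.le (by norm_num)
  let G : V p → ℂ := fun ξ => (χ (∑ i, ξ i * h i) - 1) * (heatSymbol a κ α t ξ : ℂ)
  have hG : ∀ ξ, G (ξ + η) = G ξ := by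
    intro ξ
    simp only [G]
    rw [hχ.sum_add_left, hηh, mul_one]
    rcases le_or_gt (‖ξ‖ * ‖h‖) 1 with h1 | h1
    · rw [hχ.eq_one_of_norm_le_one ((norm_sum_mul_le ξ h).trans h1)]; simp
    · rw [heatSymbol_add ha]
      refine le_of_mul_le_mul_right ?_ hx0
      calc (p : ℝ) ^ 2 * ‖η‖ * ‖x‖ = (p : ℝ) ^ 3 * 1 := by rw [mul_assoc, hηx]; ring
        _ ≤ (p : ℝ) ^ 3 * (‖ξ‖ * ‖h‖) := by gcongr
        _ = ‖ξ‖ * ((p : ℝ) ^ 3 * ‖h‖) := by ring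
        _ ≤ ‖ξ‖ * ‖x‖ := by gcongr
  set I := ∫ ξ, χ (∑ i, ξ i * x i) * G ξ ∂μ with hI
  have hdiff : heatZ p μ χ a κ α (x + h) t - heatZ p μ χ a κ α x t = I := by
    rw [heatZ_eq_integral_heatSymbol, heatZ_eq_integral_heatSymbol, ← integral_sub
      (integrable_char_mul_heatSymbol ha hκ hα ht hχ _)
      (integrable_char_mul_heatSymbol ha hκ hα ht hχ _)]
    refine integral_congr_ae (Eventually.of_forall fun ξ => ?_)
    simp only [G]
    rw [hχ.sum_add_right]; ring
  have hrot : I = χ ((p : ℚ_[p])⁻¹) * I := by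
    conv_lhs => rw [hI, ← integral_add_right_eq_self _ η]
    rw [hI, ← integral_const_mul]
    refine integral_congr_ae (Eventually.of_forall fun ξ => ?_)
    simp only []
    rw [hG, hχ.sum_add_left, hη]; ring
  have hI0 : I = 0 := by
    by_contra h0
    exact hχ.inv_prime_ne_one (mul_right_cancel₀ h0 (by rw [one_mul]; exact hrot.symm))
  rw [hI0, sub_eq_zero] at hdiff
  exact hdiff

/-- The heat kernel is flat to every order at the origin. -/
lemma exists_norm_heatZ_sub_heatZ_zero_le (hχ : IsStdChar p χ) {M : ℝ} (hM : 0 ≤ M) :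
    ∃ C : ℝ, 0 ≤ C ∧ ∀ x : V p,
      ‖heatZ p μ χ a κ α x t - heatZ p μ χ a κ α 0 t‖ ≤ C * ‖x‖ ^ M := by
  refine ⟨2 * ∫ ξ, ‖ξ‖ ^ M * heatSymbol a κ α t ξ ∂μ, mul_nonneg zero_le_two
    (integral_nonneg fun ξ => mul_nonneg (by positivity) (heatSymbol_pos ..).le), fun x => ?_⟩
  rw [heatZ_eq_integral_heatSymbol, heatZ_eq_integral_heatSymbol, ← integral_sub
      (integrable_char_mul_heatSymbol ha hκ hα ht hχ _)
      (integrable_char_mul_heatSymbol ha hκ hα ht hχ _), mul_right_comm, ← integral_const_mul]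
  refine norm_integral_le_of_norm_le
    ((integrable_norm_rpow_mul_heatSymbol ha hκ hα ht hM).const_mul _)
    (Eventually.of_forall fun ξ => ?_)
  have e : χ (∑ i, ξ i * (0 : V p) i) = 1 := by simp [hχ.map_zero]
  rw [e, ← sub_mul, norm_mul, norm_heatSymbol, ← mul_assoc]
  refine mul_le_mul_of_nonneg_right ?_ (heatSymbol_pos ..).le
  rw [mul_assoc, mul_comm (‖x‖ ^ M), ← Real.mul_rpow (norm_nonneg _) (norm_nonneg _)]
  rcases le_or_gt (‖ξ‖ * ‖x‖) 1 with h1 | h1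
  · rw [hχ.eq_one_of_norm_le_one ((norm_sum_mul_le ξ x).trans h1), sub_self, norm_zero]
    positivity
  · calc ‖χ (∑ i, ξ i * x i) - 1‖ ≤ ‖χ (∑ i, ξ i * x i)‖ + ‖(1 : ℂ)‖ := norm_sub_le _ _
      _ = 2 * 1 := by rw [hχ.norm_eq_one, norm_one]; norm_num
      _ ≤ 2 * (‖ξ‖ * ‖x‖) ^ M := by gcongr; exact Real.one_le_rpow h1.le hM

omit ha in
lemma norm_heatSymbol_sub_le {ξ η : V p} {R : ℝ} (hξ : ‖ξ‖ ≤ R) (hη : ‖η‖ ≤ R) :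
    |heatSymbol a κ α t ξ - heatSymbol a κ α t η| ≤ κ * t * R ^ (2 * α) := by
  have hR : 0 ≤ R := (norm_nonneg _).trans hξ
  have key : ∀ ζ : V p, ‖ζ‖ ≤ R →
      heatSymbol a κ α t ζ ≤ 1 ∧ 1 - κ * t * R ^ (2 * α) ≤ heatSymbol a κ α t ζ := by
    intro ζ hζ
    have h1 : ‖qfc p a ζ‖ ^ α ≤ R ^ (2 * α) := by
      rw [Real.rpow_mul hR]
      refine Real.rpow_le_rpow (norm_nonneg _) ?_ hα.le
      rw [Real.rpow_ofNat]
      exact (norm_qfc_le a ζ).trans (pow_le_pow_left₀ (norm_nonneg _) hζ 2)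
    constructor
    · exact Real.exp_le_one_iff.2 (neg_nonpos.2 (by positivity))
    · have h2 := Real.add_one_le_exp (-(κ * t * ‖qfc p a ζ‖ ^ α))
      have h3 : κ * t * ‖qfc p a ζ‖ ^ α ≤ κ * t * R ^ (2 * α) := by gcongr
      unfold heatSymbol
      linarith
  have h1 := key ξ hξ
  have h2 := key η hη
  rw [abs_le]
  constructor <;> linarith [h1.1, h1.2, h2.1, h2.2]

lemma exists_norm_heatZ_le (hχ : IsStdChar p χ) :
    ∃ C : ℝ, 0 ≤ C ∧ ∀ x : V p,
      ‖heatZ p μ χ a κ α x t‖ ≤ C * (1 + ‖x‖) ^ (-(2 * α + 4)) := by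
  have hp1 := one_lt_cast_prime (p := p)
  have hp0 : (0 : ℝ) < p := zero_lt_one.trans hp1
  set q := 2 * α + 4 with hq
  have hq0 : 0 < q := by positivity
  set A := ∫ ξ, heatSymbol a κ α t ξ ∂μ with hA
  have hA0 : 0 ≤ A := integral_nonneg fun ξ => (heatSymbol_pos ..).le
  set δ := ‖χ ((p : ℚ_[p])⁻¹) - 1‖ with hδ
  have hδ0 : 0 < δ := norm_pos_iff.2 (sub_ne_zero.2 hχ.inv_prime_ne_one)
  set m := (p : ℝ) ^ 4 * μ.real (Metric.closedBall (0 : V p) 1) with hm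
  have hm0 : 0 ≤ m := mul_nonneg (by positivity) measureReal_nonneg
  set P : ℝ := (p : ℝ) ^ 3 with hP
  have hP1 : 1 ≤ P := one_le_pow₀ hp1.le
  have hP0 : 0 < P := by positivity
  have hdec : ∀ x : V p, P ≤ ‖x‖ →
      ‖heatZ p μ χ a κ α x t‖ ≤ κ * t * m / δ * (P / ‖x‖) ^ q := by
    intro x hxP
    have hx0 : 0 < ‖x‖ := hP0.trans_le hxP
    obtain ⟨η, hη, hηx⟩ := exists_sum_mul_eq_inv_prime (norm_pos_iff.1 hx0)
    set R := P / ‖x‖ with hR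
    have hR0 : 0 < R := by positivity
    have hR1 : R ≤ 1 := (div_le_one hx0).2 hxP
    have hηR : (p : ℝ) ^ 2 * ‖η‖ = R := by
      rw [hR, eq_div_iff hx0.ne', mul_assoc, hηx, hP]; ring
    have hηR' : ‖η‖ ≤ R := by
      rw [← hηR]; exact le_mul_of_one_le_left (norm_nonneg _) (one_le_pow₀ hp1.le)
    have hint := integrable_char_mul_heatSymbol (μ := μ) ha hκ hα ht hχ x
    have hint' : Integrable (fun ξ : V p =>
        χ (∑ i, ξ i * x i) * (heatSymbol a κ α t (ξ + η) : ℂ)) μ := by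
      refine ((hint.comp_add_right η).const_mul (χ ((p : ℚ_[p])⁻¹))⁻¹).congr
        (Eventually.of_forall fun ξ => ?_)
      have hne : χ ((p : ℚ_[p])⁻¹) ≠ 0 := by
        rw [← norm_pos_iff, hχ.norm_eq_one]; exact one_pos
      simp only []
      rw [hχ.sum_add_left, hη, mul_comm (χ (∑ i, ξ i * x i)), mul_assoc, inv_mul_cancel_left₀ hne]
    have hrot : heatZ p μ χ a κ α x t = χ ((p : ℚ_[p])⁻¹) *
        ∫ ξ, χ (∑ i, ξ i * x i) * (heatSymbol a κ α t (ξ + η) : ℂ) ∂μ := by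
      rw [heatZ_eq_integral_heatSymbol, ← integral_add_right_eq_self _ η, ← integral_const_mul]
      refine integral_congr_ae (Eventually.of_forall fun ξ => ?_)
      simp only []
      rw [hχ.sum_add_left, hη]; ring
    have hZ : (χ ((p : ℚ_[p])⁻¹) - 1) * heatZ p μ χ a κ α x t = χ ((p : ℚ_[p])⁻¹) *
        ∫ ξ, χ (∑ i, ξ i * x i) *
          ((heatSymbol a κ α t ξ - heatSymbol a κ α t (ξ + η) : ℝ) : ℂ) ∂μ := by
      have e : ∫ ξ, χ (∑ i, ξ i * x i) *
          ((heatSymbol a κ α t ξ - heatSymbol a κ α t (ξ + η) : ℝ) : ℂ) ∂μ =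
          heatZ p μ χ a κ α x t -
            ∫ ξ, χ (∑ i, ξ i * x i) * (heatSymbol a κ α t (ξ + η) : ℂ) ∂μ := by
        rw [heatZ_eq_integral_heatSymbol, ← integral_sub hint hint']
        refine integral_congr_ae (Eventually.of_forall fun ξ => ?_)
        simp only []
        push_cast; ring
      rw [e, mul_sub, ← hrot]; ring
    have hbound : ‖∫ ξ, χ (∑ i, ξ i * x i) *
          ((heatSymbol a κ α t ξ - heatSymbol a κ α t (ξ + η) : ℝ) : ℂ) ∂μ‖ ≤
        μ.real (Metric.closedBall 0 R) * (κ * t * R ^ (2 * α)) := by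
      have hind : Integrable ((Metric.closedBall (0 : V p) R).indicator
          fun _ => κ * t * R ^ (2 * α)) μ :=
        (integrable_indicator_iff Metric.isClosed_closedBall.measurableSet).2
          (integrableOn_const (isCompact_closedBall _ _).measure_lt_top.ne)
      refine (norm_integral_le_of_norm_le hind (Eventually.of_forall fun ξ => ?_)).trans_eq ?_
      · rw [norm_mul, hχ.norm_eq_one, one_mul, Complex.norm_real, Real.norm_eq_abs]
        by_cases hξ : ‖ξ‖ ≤ R
        · rw [indicator_of_mem (mem_closedBall_zero_iff.2 hξ)]
          exact norm_heatSymbol_sub_le hκ hα ht hξ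
            ((IsUltrametricDist.norm_add_le_max _ _).trans (max_le hξ hηR'))
        · rw [heatSymbol_add ha (by rw [hηR]; exact (not_le.1 hξ).le), sub_self, abs_zero]
          exact indicator_nonneg (fun _ _ => by positivity) _
      · rw [integral_indicator_const _ Metric.isClosed_closedBall.measurableSet, smul_eq_mul]
    have h1 : δ * ‖heatZ p μ χ a κ α x t‖ ≤ κ * t * m * R ^ q := by
      rw [hδ, ← norm_mul, hZ, norm_mul, hχ.norm_eq_one, one_mul]
      refine hbound.trans ?_
      have h2 := measureReal_closedBall_le (μ := μ) hR0 hR1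
      have hRq : R ^ q = R ^ (2 * α) * R ^ 4 := by
        rw [hq, Real.rpow_add hR0]; norm_num
      calc _ ≤ (m * R ^ 4) * (κ * t * R ^ (2 * α)) := by gcongr
        _ = _ := by rw [hRq]; ring
    rw [div_mul_eq_mul_div, le_div_iff₀ hδ0, mul_comm]
    exact h1
  refine ⟨A * (1 + P) ^ q + κ * t * m / δ * (2 * P) ^ q, by positivity, fun x => ?_⟩
  have h1x : 0 < 1 + ‖x‖ := by positivity
  rw [Real.rpow_neg h1x.le, ← div_eq_mul_inv, add_div]
  rcases le_or_gt P ‖x‖ with h | h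
  · have hx0 : 0 < ‖x‖ := hP0.trans_le h
    refine (hdec x h).trans (le_trans ?_ (le_add_of_nonneg_left (by positivity)))
    rw [mul_div_assoc (κ * t * m / δ), ← Real.div_rpow (by positivity) h1x.le]
    refine mul_le_mul_of_nonneg_left (Real.rpow_le_rpow (by positivity) ?_ hq0.le) (by positivity)
    rw [div_le_div_iff₀ hx0 h1x]
    nlinarith
  · refine (norm_heatZ_le ha hκ hα ht hχ x).trans (le_trans ?_ (le_add_of_nonneg_right
      (by positivity)))
    rw [mul_div_assoc]
    refine le_mul_of_one_le_right hA0 ?_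
    rw [one_le_div (by positivity)]
    exact Real.rpow_le_rpow h1x.le (by linarith) hq0.le

lemma integrable_norm_heatZ_mul (hχ : IsStdChar p χ) {b : ℝ} (hb : b < 2 * α) :
    Integrable (fun x => ‖heatZ p μ χ a κ α x t‖ * (1 + ‖x‖) ^ b) μ := by
  obtain ⟨C, hC0, hC⟩ := exists_norm_heatZ_le (μ := μ) ha hκ hα ht hχ
  have hw : Continuous fun x : V p => (1 + ‖x‖) ^ b :=
    Continuous.rpow_const (by fun_prop) fun x => Or.inl (by positivity)
  refine ((integrable_one_add_norm_rpow (μ := μ) (s := 2 * α + 4 - b)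
    (by linarith)).const_mul C).mono'
    ((continuous_heatZ ha hκ hα ht hχ).norm.mul hw).aestronglyMeasurable
    (Eventually.of_forall fun x => ?_)
  have h0 : (0 : ℝ) < 1 + ‖x‖ := by positivity
  rw [Real.norm_of_nonneg (by positivity)]
  calc _ ≤ C * (1 + ‖x‖) ^ (-(2 * α + 4)) * (1 + ‖x‖) ^ b := by gcongr; exact hC x
    _ = _ := by rw [mul_assoc, ← Real.rpow_add h0]; congr 2; ring

end Symbol

end HeatKernel

section Potential

variable {p} {μ : Measure (V p)} [μ.IsAddHaarMeasure] {χ : ℚ_[p] → ℂ}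

lemma one_add_norm_add_rpow_le (x y : V p) {b : ℝ} (hb : 0 ≤ b) :
    (1 + ‖x + y‖) ^ b ≤ (1 + ‖x‖) ^ b * (1 + ‖y‖) ^ b := by
  rw [← Real.mul_rpow (by positivity) (by positivity)]
  refine Real.rpow_le_rpow (by positivity) ?_ hb
  have := norm_add_le x y
  nlinarith [norm_nonneg x, norm_nonneg y, mul_nonneg (norm_nonneg x) (norm_nonneg y)]

lemma Mlam.exists_norm_le {b : ℝ} (hb : 0 ≤ b) {φ : V p → ℂ} (hφ : Mlam p b φ) :
    ∃ K : ℝ, 0 ≤ K ∧ ∀ x, ‖φ x‖ ≤ K * (1 + ‖x‖) ^ b := by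
  obtain ⟨C, hC⟩ := hφ.2
  refine ⟨2 * |C|, by positivity, fun x => (hC x).trans ?_⟩
  have h1 : (1 : ℝ) ≤ (1 + ‖x‖) ^ b := Real.one_le_rpow (by simp) hb
  have h2 : ‖x‖ ^ b ≤ (1 + ‖x‖) ^ b := Real.rpow_le_rpow (norm_nonneg _) (by simp) hb
  calc C * (1 + ‖x‖ ^ b) ≤ |C| * ((1 + ‖x‖) ^ b + (1 + ‖x‖) ^ b) := by
        gcongr; exact le_abs_self C
    _ = _ := by ring

lemma norm_qf_rpow_le {a : ℤ} (ha : IsQNR p a) {γ : ℝ} (hγ : 0 < γ) (y : V p) :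
    ‖qf p a y‖ ^ (-γ - 2) ≤ (p : ℝ) ^ (γ + 2) * ‖y‖ ^ (-(2 * γ + 4)) := by
  have hp0 : (0 : ℝ) < p := zero_lt_one.trans one_lt_cast_prime
  rcases eq_or_ne y 0 with rfl | hy
  · have h0 : qf p a 0 = 0 := by simp [qf]
    rw [h0, norm_zero, norm_zero, Real.zero_rpow (by linarith)]
    positivity
  · have hy0 : 0 < ‖y‖ := norm_pos_iff.2 hy
    refine (Real.rpow_le_rpow_of_nonpos (by positivity) (le_norm_qf ha y) (by linarith)).trans_eq ?_
    rw [Real.mul_rpow (by positivity) (by positivity), Real.inv_rpow hp0.le, ← Real.rpow_neg hp0.le,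
      ← Real.rpow_natCast ‖y‖ 2, ← Real.rpow_mul hy0.le]
    congr 2 <;> push_cast <;> ring

lemma norm_qf_rpow_le_of_one_le {a : ℤ} (ha : IsQNR p a) {γ : ℝ} (hγ : 0 < γ) {y : V p}
    (hy : 1 ≤ ‖y‖) :
    ‖qf p a y‖ ^ (-γ - 2) ≤
      (p : ℝ) ^ (γ + 2) * 2 ^ (2 * γ + 4) * (1 + ‖y‖) ^ (-(2 * γ + 4)) := by
  have hp0 : (0 : ℝ) < p := zero_lt_one.trans one_lt_cast_prime
  refine (norm_qf_rpow_le ha hγ y).trans ?_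
  rw [mul_assoc]
  gcongr
  have hy0 : 0 < ‖y‖ := one_pos.trans_le hy
  rw [Real.rpow_neg hy0.le, Real.rpow_neg (by positivity), ← div_eq_mul_inv,
    ← Real.div_rpow (by norm_num) (by positivity), ← Real.inv_rpow hy0.le]
  refine Real.rpow_le_rpow (by positivity) ?_ (by linarith)
  rw [inv_eq_one_div, div_le_div_iff₀ hy0 (by positivity)]
  linarith

lemma measurable_norm_qf_rpow (a : ℤ) (r : ℝ) : Measurable fun y : V p => ‖qf p a y‖ ^ r :=
  (continuous_qf a).norm.measurable.pow_const r

variable {a : ℤ} (ha : IsQNR p a) {κ α t : ℝ} (hκ : 0 < κ) (hα : 0 < α) (ht : 0 < t)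
  (hχ : IsStdChar p χ) {φ : V p → ℂ} (hφ : Continuous φ) {b K : ℝ} (hb : 0 ≤ b) (hbα : b < 2 * α)
  (hK0 : 0 ≤ K) (hK : ∀ x, ‖φ x‖ ≤ K * (1 + ‖x‖) ^ b)
include ha hκ hα ht hχ hφ hb hbα hK

omit ha hκ hα ht hχ hφ hbα [μ.IsAddHaarMeasure] in
include hK0 in
lemma norm_apply_sub_le (x w : V p) :
    ‖φ (x - w)‖ ≤ K * (1 + ‖x‖) ^ b * (1 + ‖w‖) ^ b := by
  refine (hK _).trans ?_
  rw [mul_assoc]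
  gcongr
  simpa [sub_eq_add_neg] using one_add_norm_add_rpow_le x (-w) hb

include hK0

lemma integrable_heatZ_mul_sub (x : V p) :
    Integrable (fun w => heatZ p μ χ a κ α w t * φ (x - w)) μ := by
  refine ((integrable_norm_heatZ_mul (μ := μ) ha hκ hα ht hχ hbα).const_mul
    (K * (1 + ‖x‖) ^ b)).mono' ?_ (Eventually.of_forall fun w => ?_)
  · exact ((continuous_heatZ ha hκ hα ht hχ).mul
      (hφ.comp (continuous_const.sub continuous_id))).aestronglyMeasurable
  · rw [norm_mul]
    calc _ ≤ ‖heatZ p μ χ a κ α w t‖ * (K * (1 + ‖x‖) ^ b * (1 + ‖w‖) ^ b) := by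
          gcongr; exact norm_apply_sub_le hb hK0 hK x w
      _ = _ := by ring

lemma integrable_heatZ_add_mul_sub (x h : V p) :
    Integrable (fun w => heatZ p μ χ a κ α (w + h) t * φ (x - w)) μ := by
  have := (integrable_heatZ_mul_sub (μ := μ) ha hκ hα ht hχ hφ hb hbα hK0 hK
    (x + h)).comp_add_right h
  simpa using this

omit ha hκ hα ht hχ hφ hb hbα hK hK0 in
lemma heatPot1_add (x h : V p) :
    heatPot1 p μ χ a κ α φ (x + h) t = ∫ w, heatZ p μ χ a κ α (w + h) t * φ (x - w) ∂μ := by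
  rw [heatPot1, ← integral_sub_left_eq_self _ μ x]
  refine integral_congr_ae (Eventually.of_forall fun w => ?_)
  simp only []
  congr 2
  abel

omit ha hκ hα ht hχ hφ hb hbα hK hK0 in
lemma heatPot1_eq (x : V p) :
    heatPot1 p μ χ a κ α φ x t = ∫ w, heatZ p μ χ a κ α w t * φ (x - w) ∂μ := by
  simpa using heatPot1_add (μ := μ) (χ := χ) (a := a) (κ := κ) (α := α) (t := t) (φ := φ) x 0

omit hφ in
lemma norm_heatPot1_le (x : V p) :
    ‖heatPot1 p μ χ a κ α φ x t‖ ≤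
      K * (∫ w, ‖heatZ p μ χ a κ α w t‖ * (1 + ‖w‖) ^ b ∂μ) * (1 + ‖x‖) ^ b := by
  rw [heatPot1_eq, mul_right_comm, ← integral_const_mul]
  refine norm_integral_le_of_norm_le
    ((integrable_norm_heatZ_mul (μ := μ) ha hκ hα ht hχ hbα).const_mul _)
    (Eventually.of_forall fun w => ?_)
  rw [norm_mul]
  calc _ ≤ ‖heatZ p μ χ a κ α w t‖ * (K * (1 + ‖x‖) ^ b * (1 + ‖w‖) ^ b) := by
        gcongr; exact norm_apply_sub_le hb hK0 hK x w
    _ = _ := by ring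

lemma isLocallyConstant_heatPot1 (hloc : IsLocallyConstant φ) :
    IsLocallyConstant fun x => heatPot1 p μ χ a κ α φ x t := by
  have hp0 : (0 : ℝ) < p := zero_lt_one.trans one_lt_cast_prime
  rw [IsLocallyConstant.iff_eventually_eq]
  intro x
  obtain ⟨ε, hε, hball⟩ := Metric.eventually_nhds_iff.1 (hloc.eventually_eq x)
  refine Metric.eventually_nhds_iff.2 ⟨ε / (p : ℝ) ^ 3, by positivity, fun {y} hy => ?_⟩
  rw [dist_eq_norm, lt_div_iff₀ (by positivity), mul_comm] at hy
  set h := y - x with hh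
  have hyx : y = x + h := by rw [hh]; abel
  have hZ : Integrable (fun w => heatZ p μ χ a κ α w t) μ := by
    have h0 := integrable_norm_heatZ_mul (μ := μ) ha hκ hα ht hχ (b := 0) (by positivity)
    simp only [Real.rpow_zero, mul_one] at h0
    exact (integrable_norm_iff (continuous_heatZ ha hκ hα ht hχ).aestronglyMeasurable).1 h0
  rw [← sub_eq_zero, hyx, heatPot1_add, heatPot1_eq, ← integral_sub
    (integrable_heatZ_add_mul_sub ha hκ hα ht hχ hφ hb hbα hK0 hK x h)
    (integrable_heatZ_mul_sub ha hκ hα ht hχ hφ hb hbα hK0 hK x)]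
  have e : ∀ w, heatZ p μ χ a κ α (w + h) t * φ (x - w) - heatZ p μ χ a κ α w t * φ (x - w)
      = (heatZ p μ χ a κ α (w + h) t - heatZ p μ χ a κ α w t) * φ x := by
    intro w
    rw [← sub_mul]
    rcases lt_or_ge ‖w‖ ε with hw | hw
    · rw [hball (y := x - w) (by simpa [dist_eq_norm] using hw)]
    · rw [heatZ_add ha hκ hα ht hχ (hy.le.trans hw), sub_self, zero_mul, zero_mul]
  simp only [e]
  rw [integral_mul_const, integral_sub (hZ.comp_add_right h) hZ,
    integral_add_right_eq_self (fun w => heatZ p μ χ a κ α w t) h, sub_self, zero_mul]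

lemma inDomain_heatPot1 (hloc : IsLocallyConstant φ) {γ : ℝ} (hγ : b < 2 * γ) :
    InDomain p μ a γ fun x => heatPot1 p μ χ a κ α φ x t := by
  have hu := isLocallyConstant_heatPot1 (μ := μ) ha hκ hα ht hχ hφ hb hbα hK0 hK hloc
  have hp0 : (0 : ℝ) < p := zero_lt_one.trans one_lt_cast_prime
  refine ⟨hu, 0, ?_⟩
  set B := K * ∫ w, ‖heatZ p μ χ a κ α w t‖ * (1 + ‖w‖) ^ b ∂μ with hB
  have hB0 : 0 ≤ B := mul_nonneg hK0 (integral_nonneg fun w => by positivity)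
  refine Integrable.mono' (((integrable_one_add_norm_rpow (μ := μ) (s := 2 * γ + 4 - b)
    (by linarith)).const_mul (B * ((p : ℝ) ^ (γ + 2) * 2 ^ (2 * γ + 4)))).integrableOn) ?_ ?_
  · exact (hu.continuous.norm.measurable.mul
      (measurable_norm_qf_rpow a (-γ - 2))).aestronglyMeasurable
  · refine ae_restrict_of_forall_mem
      (isClosed_le continuous_const continuous_norm).measurableSet fun x hx => ?_
    have hx1 : 1 ≤ ‖x‖ := by simpa using hx
    have h0 : (0 : ℝ) < 1 + ‖x‖ := by positivity
    rw [Real.norm_of_nonneg (by positivity)]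
    calc _ ≤ B * (1 + ‖x‖) ^ b *
          ((p : ℝ) ^ (γ + 2) * 2 ^ (2 * γ + 4) * (1 + ‖x‖) ^ (-(2 * γ + 4))) := by
          gcongr
          · exact norm_heatPot1_le ha hκ hα ht hχ hb hbα hK0 hK x
          · exact norm_qf_rpow_le_of_one_le ha (by linarith) hx1
      _ = B * ((p : ℝ) ^ (γ + 2) * 2 ^ (2 * γ + 4)) *
          ((1 + ‖x‖) ^ b * (1 + ‖x‖) ^ (-(2 * γ + 4))) := by ring
      _ = _ := by rw [← Real.rpow_add h0]; congr 2; ring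

/-- Absolute convergence of the double integral behind `f(∂,γ) (Z_t * φ)`. -/
lemma integrable_prod_heatZ_sub (x : V p) {γ : ℝ} (hγ : b < 2 * γ) :
    Integrable (fun q : V p × V p =>
      (heatZ p μ χ a κ α (q.1 - q.2) t - heatZ p μ χ a κ α q.1 t) * φ (x - q.1) *
        ((‖qf p a q.2‖ ^ (-γ - 2) : ℝ) : ℂ)) (μ.prod μ) := by
  have hp1 := one_lt_cast_prime (p := p)
  have hp0 : (0 : ℝ) < p := zero_lt_one.trans hp1
  have hγ0 : 0 < γ := by linarith
  set s := 2 * γ + 4 with hs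
  have hs0 : 0 < s := by positivity
  set P : ℝ := (p : ℝ) ^ 3 with hP
  have hP1 : 1 ≤ P := one_le_pow₀ hp1.le
  obtain ⟨M, hM0, hM⟩ := exists_norm_heatZ_sub_heatZ_zero_le (μ := μ) ha hκ hα ht hχ hs0.le
  have hZc := continuous_heatZ (μ := μ) ha hκ hα ht hχ
  set Z : V p → ℂ := fun w => heatZ p μ χ a κ α w t with hZ
  let A : V p → ℝ := fun w => ‖Z w‖ * (1 + ‖w‖) ^ b
  have hA : Integrable A μ := integrable_norm_heatZ_mul ha hκ hα ht hχ hbα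
  let W : V p → ℝ := fun y => (1 + ‖y‖) ^ (-(s - b))
  have hW : Integrable W μ := integrable_one_add_norm_rpow (by linarith)
  let ind : ℝ → V p → ℝ := fun R => (Metric.closedBall (0 : V p) R).indicator 1
  have hind : ∀ R, Integrable (ind R) μ := fun R =>
    (integrable_indicator_iff Metric.isClosed_closedBall.measurableSet).2
      (integrableOn_const (isCompact_closedBall _ _).measure_lt_top.ne)
  have hind0 : ∀ R x, 0 ≤ ind R x := fun R x => indicator_nonneg (fun _ _ => zero_le_one) _
  set D : ℝ := (p : ℝ) ^ (γ + 2) * 2 ^ s with hD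
  have hD0 : 0 ≤ D := by positivity
  set Kx : ℝ := K * (1 + ‖x‖) ^ b with hKx
  have hKx0 : 0 ≤ Kx := by positivity
  have hφK : ∀ w, ‖φ (x - w)‖ ≤ Kx * (1 + ‖w‖) ^ b := norm_apply_sub_le hb hK0 hK x
  set C₁ : ℝ := 2 * M * P ^ s * (p : ℝ) ^ (γ + 2) * (Kx * (1 + P) ^ b) with hC₁
  have hC₁0 : 0 ≤ C₁ := by positivity
  have hconv : Integrable (fun q : V p × V p => W q.2 * A (q.1 - q.2)) (μ.prod μ) :=
    hW.convolution_integrand (ContinuousLinearMap.mul ℝ ℝ) hA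
  have hdom := (((hind P).mul_prod (hind 1)).const_mul C₁).add
    ((hconv.add (hA.mul_prod hW)).const_mul (Kx * D))
  refine hdom.mono' ?_ (Eventually.of_forall fun q => ?_)
  · refine AEStronglyMeasurable.mul (Continuous.aestronglyMeasurable ?_) ?_
    · have hZ1 : Continuous fun q : V p × V p => Z (q.1 - q.2) :=
        hZc.comp (continuous_fst.sub continuous_snd)
      have hZ2 : Continuous fun q : V p × V p => Z q.1 := hZc.comp continuous_fst
      have hφ1 : Continuous fun q : V p × V p => φ (x - q.1) :=
        hφ.comp (continuous_const.sub continuous_fst)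
      exact (hZ1.sub hZ2).mul hφ1
    · exact (Complex.measurable_ofReal.comp
        ((measurable_norm_qf_rpow a (-γ - 2)).comp measurable_snd)).aestronglyMeasurable
  obtain ⟨w, y⟩ := q
  have hk0 : 0 ≤ ‖qf p a y‖ ^ (-γ - 2) := by positivity
  have hAW : 0 ≤ Kx * D * (W y * A (w - y) + A w * W y) := by positivity
  have hII : 0 ≤ C₁ * (ind P w * ind 1 y) :=
    mul_nonneg hC₁0 (mul_nonneg (hind0 _ _) (hind0 _ _))
  change ‖(Z (w - y) - Z w) * φ (x - w) * ((‖qf p a y‖ ^ (-γ - 2) : ℝ) : ℂ)‖ ≤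
    C₁ * (ind P w * ind 1 y) + Kx * D * (W y * A (w - y) + A w * W y)
  rw [norm_mul, norm_mul, Complex.norm_real, Real.norm_of_nonneg hk0]
  rcases le_or_gt ‖y‖ 1 with hy | hy
  · rcases le_or_gt (P * ‖y‖) ‖w‖ with hw | hw
    · have h0 : Z (w - y) = Z w := by
        rw [sub_eq_add_neg]
        exact heatZ_add ha hκ hα ht hχ (by rwa [norm_neg])
      rw [h0, sub_self, norm_zero, zero_mul, zero_mul]
      positivity
    · refine le_add_of_le_of_nonneg ?_ hAW
      have hy0 : 0 < ‖y‖ := by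
        by_contra h0
        have h1 : ‖y‖ = 0 := le_antisymm (not_lt.1 h0) (norm_nonneg _)
        rw [h1, mul_zero] at hw
        exact absurd hw (not_lt.2 (norm_nonneg _))
      have hwP : ‖w‖ ≤ P := hw.le.trans (mul_le_of_le_one_right (by positivity) hy)
      have hwy : ‖w - y‖ ≤ P * ‖y‖ := by
        rw [sub_eq_add_neg]
        refine (IsUltrametricDist.norm_add_le_max _ _).trans (max_le hw.le ?_)
        rw [norm_neg]
        exact le_mul_of_one_le_left (norm_nonneg _) hP1
      have hdiff : ‖Z (w - y) - Z w‖ ≤ 2 * M * (P ^ s * ‖y‖ ^ s) := by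
        have e : Z (w - y) - Z w = (Z (w - y) - Z 0) - (Z w - Z 0) := by ring
        rw [e, ← Real.mul_rpow (by positivity) hy0.le]
        refine (norm_sub_le _ _).trans ?_
        have h1 : ‖Z (w - y) - Z 0‖ ≤ M * (P * ‖y‖) ^ s :=
          (hM _).trans (by gcongr)
        have h2 : ‖Z w - Z 0‖ ≤ M * (P * ‖y‖) ^ s :=
          (hM _).trans (by gcongr)
        linarith
      have hi1 : ind P w = 1 := indicator_of_mem (mem_closedBall_zero_iff.2 hwP) _
      have hi2 : ind 1 y = 1 := indicator_of_mem (mem_closedBall_zero_iff.2 hy) _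
      rw [hi1, hi2, mul_one, mul_one]
      calc _ ≤ 2 * M * (P ^ s * ‖y‖ ^ s) * (Kx * (1 + P) ^ b) *
            ((p : ℝ) ^ (γ + 2) * ‖y‖ ^ (-s)) := by
            gcongr
            · exact (hφK w).trans (by gcongr)
            · exact norm_qf_rpow_le ha hγ0 y
        _ = C₁ * (‖y‖ ^ s * ‖y‖ ^ (-s)) := by rw [hC₁]; ring
        _ = C₁ := by rw [← Real.rpow_add hy0, add_neg_cancel, Real.rpow_zero, mul_one]
  · refine le_add_of_nonneg_of_le hII ?_
    have h1y : 0 < 1 + ‖y‖ := by positivity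
    have hk := norm_qf_rpow_le_of_one_le ha hγ0 hy.le
    have hWy : (1 + ‖y‖) ^ b * (1 + ‖y‖) ^ (-s) = W y := by
      rw [← Real.rpow_add h1y]; simp only [W]; congr 1; ring
    have h1 : ‖Z (w - y)‖ * (1 + ‖w‖) ^ b ≤ A (w - y) * (1 + ‖y‖) ^ b := by
      simp only [A]
      rw [mul_assoc]
      gcongr
      simpa using one_add_norm_add_rpow_le (w - y) y hb
    have h2 : ‖Z w‖ * (1 + ‖w‖) ^ b ≤ A w * (1 + ‖y‖) ^ b :=
      le_mul_of_one_le_right (by positivity) (Real.one_le_rpow (by simp) hb)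
    calc _ ≤ (‖Z (w - y)‖ + ‖Z w‖) * (Kx * (1 + ‖w‖) ^ b) * (D * (1 + ‖y‖) ^ (-s)) := by
          gcongr
          · exact norm_sub_le _ _
          · exact hφK w
      _ = Kx * D * (1 + ‖y‖) ^ (-s) *
            (‖Z (w - y)‖ * (1 + ‖w‖) ^ b + ‖Z w‖ * (1 + ‖w‖) ^ b) := by ring
      _ ≤ Kx * D * (1 + ‖y‖) ^ (-s) *
            (A (w - y) * (1 + ‖y‖) ^ b + A w * (1 + ‖y‖) ^ b) := by gcongr
      _ = Kx * D * (A (w - y) + A w) * ((1 + ‖y‖) ^ b * (1 + ‖y‖) ^ (-s)) := by ring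
      _ = _ := by rw [hWy]; ring

lemma fop_heatPot1 (x : V p) {γ : ℝ} (hγ : b < 2 * γ) :
    fop p μ a γ (fun y => heatPot1 p μ χ a κ α φ y t) x =
      ∫ y, fop p μ a γ (fun z => heatZ p μ χ a κ α z t) (x - y) * φ y ∂μ := by
  rw [← integral_sub_left_eq_self _ μ x]
  simp only [fop, sub_sub_cancel, mul_assoc]
  rw [integral_const_mul]
  congr 1
  have hF := integrable_prod_heatZ_sub (μ := μ) ha hκ hα ht hχ hφ hb hbα hK0 hK x hγ
  have hswap := integral_integral_swap (μ := μ) (ν := μ) (f := fun w y =>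
    (heatZ p μ χ a κ α (w - y) t - heatZ p μ χ a κ α w t) * φ (x - w) *
        ((‖qf p a y‖ ^ (-γ - 2) : ℝ) : ℂ)) hF
  have hL : ∀ y, (heatPot1 p μ χ a κ α φ (x - y) t - heatPot1 p μ χ a κ α φ x t) *
      ((‖qf p a y‖ ^ (-γ - 2) : ℝ) : ℂ) =
      ∫ w, (heatZ p μ χ a κ α (w - y) t - heatZ p μ χ a κ α w t) * φ (x - w) *
        ((‖qf p a y‖ ^ (-γ - 2) : ℝ) : ℂ) ∂μ := by
    intro y
    rw [integral_mul_const, sub_eq_add_neg x y, heatPot1_add, heatPot1_eq, ← integral_sub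
      (integrable_heatZ_add_mul_sub ha hκ hα ht hχ hφ hb hbα hK0 hK x (-y))
      (integrable_heatZ_mul_sub ha hκ hα ht hχ hφ hb hbα hK0 hK x)]
    simp only [sub_mul, ← sub_eq_add_neg]
  have hR : ∀ w, (∫ y, (heatZ p μ χ a κ α (w - y) t - heatZ p μ χ a κ α w t) *
      ((‖qf p a y‖ ^ (-γ - 2) : ℝ) : ℂ) ∂μ) * φ (x - w) =
      ∫ y, (heatZ p μ χ a κ α (w - y) t - heatZ p μ χ a κ α w t) * φ (x - w) *
        ((‖qf p a y‖ ^ (-γ - 2) : ℝ) : ℂ) ∂μ := by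
    intro w
    rw [← integral_mul_const]
    simp only [mul_right_comm]
  simp only [hL, hR]
  exact hswap.symm

end Potential

/-- for `0 ≤ λ < γ ≤ α` and `φ ∈ 𝔐_{2λ}`, for every `t > 0` the potential
`u₁(·,t)` lies in the domain of `f(∂,γ)` and
`(f(∂,γ)u₁)(x,t) = ∫ (f(∂,γ)Z_t)(x − y) φ(y) d⁴y`. -/
theorem statement16
    (hp : p ≠ 2) (a : ℤ) (ha : IsQNR p a)
    (μ : Measure (V p)) [μ.IsAddHaarMeasure] (hμ : μ {x : V p | ‖x‖ ≤ 1} = 1)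
    (χ : ℚ_[p] → ℂ) (hχ : IsStdChar p χ)
    (κ α γ lam : ℝ) (hκ : 0 < κ) (hα : 0 < α) (hlam0 : 0 ≤ lam)
    (hlamγ : lam < γ) (hγα : γ ≤ α)
    (φ : V p → ℂ) (hφ : Mlam p (2 * lam) φ) (t : ℝ) (ht : 0 < t) :
    InDomain p μ a γ (fun y => heatPot1 p μ χ a κ α φ y t) ∧
    ∀ x : V p, fop p μ a γ (fun y => heatPot1 p μ χ a κ α φ y t) x =
      ∫ y, fop p μ a γ (fun z => heatZ p μ χ a κ α z t) (x - y) * φ y ∂μ := by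
  have hb : 0 ≤ 2 * lam := by positivity
  have hbα : 2 * lam < 2 * α := by linarith
  have hbγ : 2 * lam < 2 * γ := by linarith
  obtain ⟨K, hK0, hK⟩ := hφ.exists_norm_le hb
  exact ⟨inDomain_heatPot1 ha hκ hα ht hχ hφ.1.continuous hb hbα hK0 hK hφ.1 hbγ,
    fun x => fop_heatPot1 ha hκ hα ht hχ hφ.1.continuous hb hbα hK0 hK x hbγ⟩

end PadicParabolic
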